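/- Let m be even and let {P_1, …, P_n} be an (n, m/2, m)-fusion frame over 𝔽 with n = 2·d_𝔽(m) and max_{j≠k} tr(P_j P_k) = (m/2)²/m = m/4 (a maximal orthoplectic fusion frame). Then (1/n²)·∑_{i,j=1}^n (tr(P_i P_j))² = tr(K_{2,m/2,m}²) = m²(d_𝔽(m)+1)/(16·d_𝔽(m)), and the fusion frame is a Grassmannian 2-design. -/

import Mathlib

open Matrix MeasureTheory
open scoped Kronecker

noncomputable section

variable {𝕜 : Type*} [RCLike 𝕜]

attribute [local instance] Matrix.frobeniusNormedAddCommGroup Matrix.frobeniusNormedSpace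

instance matrixMeasurableSpace {m : ℕ} : MeasurableSpace (Matrix (Fin m) (Fin m) 𝕜) :=
  inferInstanceAs (MeasurableSpace (Fin m → Fin m → 𝕜))

open scoped Classical in
/-- `d_𝔽(m)`: `(m+2)(m-1)/2` in the real case, `m² - 1` in the complex case. -/
noncomputable def dF (𝕜 : Type*) [RCLike 𝕜] (m : ℕ) : ℕ :=
  if (RCLike.I : 𝕜) = 0 then (m + 2) * (m - 1) / 2 else m ^ 2 - 1

/-- An `(n,l,m)`-fusion frame: a family of rank-`l` orthogonal projections on `𝕜^m`
satisfying the frame inequality. -/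
def IsFusionFrame {ι : Type*} [Fintype ι] {m : ℕ} (l : ℕ)
    (P : ι → Matrix (Fin m) (Fin m) 𝕜) : Prop :=
  (∀ j, (P j).IsHermitian) ∧ (∀ j, P j * P j = P j) ∧ (∀ j, (P j).rank = l) ∧
  ∃ A B : ℝ, 0 < A ∧ A ≤ B ∧ ∀ x : Fin m → 𝕜,
    A * ∑ i, ‖x i‖ ^ 2 ≤ ∑ j, ∑ i, ‖(P j).mulVec x i‖ ^ 2 ∧
    ∑ j, ∑ i, ‖(P j).mulVec x i‖ ^ 2 ≤ B * ∑ i, ‖x i‖ ^ 2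

/-- A Grassmannian `2`-design: the sum of the Kronecker squares of the projections
is invariant under simultaneous conjugation by any unitary (orthogonal, if `𝕜 = ℝ`). -/
def IsGrassmannian2Design {ι : Type*} [Fintype ι] {m : ℕ}
    (P : ι → Matrix (Fin m) (Fin m) 𝕜) : Prop :=
  ∀ U : Matrix.unitaryGroup (Fin m) 𝕜,
    ∑ j, (P j) ⊗ₖ (P j) =
      ∑ j, ((U : Matrix (Fin m) (Fin m) 𝕜) * P j * star (U : Matrix (Fin m) (Fin m) 𝕜)) ⊗ₖ
        ((U : Matrix (Fin m) (Fin m) 𝕜) * P j * star (U : Matrix (Fin m) (Fin m) 𝕜))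

/-! ### Families of vectors with nonpositive pairwise inner products -/

section ObtuseFamily

variable {E : Type*} [AddCommGroup E] [Module ℝ E] [FiniteDimensional ℝ E]

/-- Nonzero vectors in a `d`-dimensional space with pairwise nonpositive inner products number
at most `2d`. -/
theorem card_le_two_mul_finrank_of_nonpos (B : LinearMap.BilinForm ℝ E)
    (hsymm : ∀ x y, B x y = B y x) (d : ℕ) :
    ∀ (W : Submodule ℝ E), Module.finrank ℝ W ≤ d → (∀ x ∈ W, x ≠ 0 → 0 < B x x) →
      ∀ {ι : Type} (s : Finset ι) (v : ι → E), (∀ i ∈ s, v i ∈ W) → (∀ i ∈ s, v i ≠ 0) →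
        (∀ i ∈ s, ∀ j ∈ s, i ≠ j → B (v i) (v j) ≤ 0) → s.card ≤ 2 * d := by
  classical
  induction d with
  | zero =>
    intro W hW _ ι s v hv hne _
    have hbot : W = ⊥ := Submodule.finrank_eq_zero.1 (Nat.le_zero.1 hW)
    rcases s.eq_empty_or_nonempty with rfl | ⟨i, hi⟩
    · simp
    · exact absurd (by simpa [hbot] using hv i hi) (hne i hi)
  | succ d ih =>
    intro W hW hpos ι s v hv hne hle
    rcases s.eq_empty_or_nonempty with rfl | ⟨o, ho⟩
    · simp
    have hoo : 0 < B (v o) (v o) := hpos _ (hv o ho) (hne o ho)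
    set c : ι → ℝ := fun i => B (v o) (v i) / B (v o) (v o) with hc
    have hcle : ∀ i ∈ s, i ≠ o → c i ≤ 0 := fun i hi hio =>
      div_nonpos_of_nonpos_of_nonneg (hle o ho i hi hio.symm) hoo.le
    set w : ι → E := fun i => v i - c i • v o with hw
    have hBw : ∀ i, B (v o) (w i) = 0 := fun i => by
      simp only [hw, hc, map_sub, map_smul, smul_eq_mul]
      field_simp
      ring
    have hww : ∀ i j, B (w i) (w j) = B (v i) (v j) - c i * c j * B (v o) (v o) := fun i j => by
      have h : B (w i) (w j) = B (v i) (w j) := by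
        rw [show w i = v i - c i • v o from rfl, LinearMap.map_sub₂, LinearMap.map_smul₂, hBw,
          smul_zero, sub_zero]
      have hi : B (v i) (v o) = c i * B (v o) (v o) := by
        rw [hsymm, hc]
        field_simp
      rw [h, show w j = v j - c j • v o from rfl, map_sub, map_smul, smul_eq_mul, hi]
      ring
    set W' : Submodule ℝ E := W ⊓ LinearMap.ker (B (v o)) with hW'
    have hlt : W' < W := by
      refine lt_of_le_of_ne inf_le_left fun h => ?_
      have : v o ∈ W' := h ▸ hv o ho
      exact hoo.ne' this.2
    have hfin : Module.finrank ℝ W' ≤ d := by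
      have := Submodule.finrank_lt_finrank_of_lt hlt
      omega
    set z := (s.erase o).filter fun i => w i = 0 with hz
    set t := (s.erase o).filter fun i => ¬ w i = 0 with ht
    have hzcard : z.card ≤ 1 := by
      refine Finset.card_le_one.2 fun i hi j hj => ?_
      by_contra hij
      simp only [hz, Finset.mem_filter, Finset.mem_erase] at hi hj
      have hvi : v i = c i • v o := sub_eq_zero.1 hi.2
      have hvj : v j = c j • v o := sub_eq_zero.1 hj.2
      have hci : c i ≠ 0 := fun h => hne i hi.1.2 (by rw [hvi, h, zero_smul])
      have hcj : c j ≠ 0 := fun h => hne j hj.1.2 (by rw [hvj, h, zero_smul])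
      have h1 := (hcle i hi.1.2 hi.1.1).lt_of_ne hci
      have h2 := (hcle j hj.1.2 hj.1.1).lt_of_ne hcj
      have h3 := hle i hi.1.2 j hj.1.2 hij
      have h4 := hww i j
      rw [hi.2, map_zero, LinearMap.zero_apply] at h4
      nlinarith [mul_pos (mul_pos_of_neg_of_neg h1 h2) hoo]
    have htcard : t.card ≤ 2 * d := by
      refine ih W' hfin (fun x hx => hpos x hx.1) t w (fun i hi => ?_) (fun i hi => ?_)
        fun i hi j hj hij => ?_
      · simp only [ht, Finset.mem_filter, Finset.mem_erase] at hi
        exact ⟨W.sub_mem (hv i hi.1.2) (W.smul_mem _ (hv o ho)), hBw i⟩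
      · exact (Finset.mem_filter.1 hi).2
      · simp only [ht, Finset.mem_filter, Finset.mem_erase] at hi hj
        rw [hww]
        have h1 := hcle i hi.1.2 hi.1.1
        have h2 := hcle j hj.1.2 hj.1.1
        have h3 := hle i hi.1.2 j hj.1.2 hij
        nlinarith [mul_nonneg (mul_nonneg_of_nonpos_of_nonpos h1 h2) hoo.le]
    have h1 : z.card + t.card = (s.erase o).card := Finset.card_filter_add_card_filter_not _
    have h2 := Finset.card_erase_add_one ho
    omega

/-- A family of `2d` vectors of equal positive norm with pairwise nonpositive inner products in a
space of dimension at most `d` consists of antipodal pairs: its sum vanishes and it is a tight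
frame. -/
theorem sum_eq_zero_and_sum_smul_eq_of_nonpos (B : LinearMap.BilinForm ℝ E)
    (hsymm : ∀ x y, B x y = B y x) (W : Submodule ℝ E) (hpos : ∀ x ∈ W, x ≠ 0 → 0 < B x x)
    {n d : ℕ} (hn : n = 2 * d) (hW : Module.finrank ℝ W ≤ d) (v : Fin n → E)
    (hv : ∀ i, v i ∈ W) {c : ℝ} (hc : 0 < c) (hnorm : ∀ i, B (v i) (v i) = c)
    (hle : ∀ i j, i ≠ j → B (v i) (v j) ≤ 0) :
    ∑ i, v i = 0 ∧ ∀ x ∈ W, ∑ i, B x (v i) • v i = (2 * c) • x := by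
  classical
  have hne : ∀ i, v i ≠ 0 := fun i h => by
    have := hnorm i
    simp [h] at this
    exact hc.ne this
  -- a nonzero vector of `W` cannot be orthogonal, or at a nonpositive angle, to all of them
  have hmax : ∀ x ∈ W, (∀ i, B x (v i) ≤ 0) → x = 0 := by
    intro x hx hxv
    by_contra hx0
    have := card_le_two_mul_finrank_of_nonpos B hsymm d W hW hpos
      (Finset.univ : Finset (Option (Fin n))) (fun i => i.elim x v)
      (by rintro (_ | i) _; exacts [hx, hv i]) (by rintro (_ | i) _; exacts [hx0, hne i])
      (by
        rintro (_ | i) _ (_ | j) _ hij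
        · exact absurd rfl hij
        · exact hxv j
        · exact (hsymm _ _).trans_le (hxv i)
        · exact hle i j fun h => hij (by rw [h]))
    simp at this
    omega
  have hex : ∀ i, ∃ j, v j = - v i := by
    intro i
    by_contra! hcon
    refine hne i (neg_eq_zero.1 ?_)
    by_contra hcon'
    have hdet : ∀ j, j ≠ i → v j - (B (v i) (v j) / c) • v i ≠ 0 := by
      intro j hj h
      have hvj := sub_eq_zero.1 h
      set a := B (v i) (v j) / c with ha
      have h1 : a * a * c = c := by
        have := hnorm j
        rw [hvj] at this
        simpa [hnorm i, mul_assoc] using this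
      have ha0 : a ≤ 0 := div_nonpos_of_nonpos_of_nonneg (hle i j hj.symm) hc.le
      have h2 : a * a = 1 := by
        have : (a * a - 1) * c = 0 := by linarith
        rcases mul_eq_zero.1 this with h | h
        · linarith
        · exact absurd h hc.ne'
      have h3 : a = -1 := by nlinarith
      exact hcon j (by rw [hvj, h3, neg_one_smul])
    set W' : Submodule ℝ E := W ⊓ LinearMap.ker (B (v i)) with hW'
    have hlt : W' < W := by
      refine lt_of_le_of_ne inf_le_left fun h => ?_
      have : v i ∈ W' := h ▸ hv i
      have h0 : B (v i) (v i) = 0 := this.2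
      rw [hnorm] at h0
      exact hc.ne' h0
    have hfin : Module.finrank ℝ W' ≤ d - 1 := by
      have := Submodule.finrank_lt_finrank_of_lt hlt
      omega
    have hBw : ∀ j, B (v i) (v j - (B (v i) (v j) / c) • v i) = 0 := fun j => by
      rw [map_sub, map_smul, hnorm, smul_eq_mul]
      field_simp
      ring
    have := card_le_two_mul_finrank_of_nonpos B hsymm (d - 1) W' hfin (fun x hx => hpos x hx.1)
      (Finset.univ.erase i) (fun j => v j - (B (v i) (v j) / c) • v i)
      (fun j _ => ⟨W.sub_mem (hv j) (W.smul_mem _ (hv i)), hBw j⟩)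
      (fun j hj => hdet j (Finset.ne_of_mem_erase hj))
      (fun j hj k hk hjk => by
        have h1 := hle i j (Finset.ne_of_mem_erase hj).symm
        have h2 := hle i k (Finset.ne_of_mem_erase hk).symm
        have h3 := hle j k hjk
        have h4 : B (v j - (B (v i) (v j) / c) • v i) (v k - (B (v i) (v k) / c) • v i)
            = B (v j) (v k) - B (v i) (v j) * B (v i) (v k) / c := by
          rw [LinearMap.map_sub₂, LinearMap.map_smul₂, hBw, smul_zero, sub_zero, map_sub,
            map_smul, hsymm (v j) (v i), smul_eq_mul]
          ring
        have h5 : 0 ≤ B (v i) (v j) * B (v i) (v k) / c :=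
          div_nonneg (mul_nonneg_of_nonpos_of_nonpos h1 h2) hc.le
        change B (v j - (B (v i) (v j) / c) • v i) (v k - (B (v i) (v k) / c) • v i) ≤ 0
        rw [h4]
        linarith)
    rw [Finset.card_erase_of_mem (Finset.mem_univ _), Finset.card_univ, Fintype.card_fin] at this
    have := i.pos
    omega
  choose σ hσ using hex
  have hinj : Function.Injective v := fun i j hij => by
    by_contra h
    have := hle i j h
    rw [hij, hnorm] at this
    exact absurd hc this.not_gt
  have hσσ : Function.Involutive σ := fun i => hinj (by rw [hσ, hσ, neg_neg])
  have hsum : ∑ i, v i = 0 := by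
    have h : ∑ i, v (σ i) = ∑ i, v i := hσσ.bijective.sum_comp v
    simp only [hσ, Finset.sum_neg_distrib] at h
    have h2 : (2 : ℝ) • ∑ i, v i = 0 := by
      rw [two_smul]
      nth_rewrite 1 [← h]
      simp
    simpa using h2
  refine ⟨hsum, fun x hx => ?_⟩
  have horth : ∀ i k, k ≠ i → k ≠ σ i → B (v i) (v k) = 0 := by
    intro i k h1 h2
    have h3 := hle (σ i) k h2.symm
    rw [hσ, map_neg, LinearMap.neg_apply] at h3
    linarith [hle i k h1.symm]
  have hframe : ∀ i, ∑ k, B (v i) (v k) • v k = (2 * c) • v i := by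
    intro i
    have hi : i ≠ σ i := fun h => by
      have h1 := hnorm (σ i)
      have h2 := hnorm i
      rw [hσ, map_neg] at h1
      nth_rewrite 1 [h] at h2
      rw [hσ] at h2
      rw [map_neg, LinearMap.neg_apply, neg_neg] at h1
      rw [map_neg, LinearMap.neg_apply] at h2
      linarith
    rw [Finset.sum_eq_add i (σ i) hi (fun k _ hk => by rw [horth i k hk.1 hk.2, zero_smul])
      (by simp) (by simp), hσ, map_neg, hnorm, two_mul, add_smul]
    simp
  set y := (2 * c) • x - ∑ k, B x (v k) • v k with hy
  have hyW : y ∈ W := W.sub_mem (W.smul_mem _ hx) (W.sum_mem fun k _ => W.smul_mem _ (hv k))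
  have hy0 : y = 0 := hmax y hyW fun i => le_of_eq <| by
    have h := congrArg (B x) (hframe i)
    simp only [map_sum, map_smul, smul_eq_mul] at h
    rw [hy, map_sub, LinearMap.sub_apply, map_smul, LinearMap.smul_apply, smul_eq_mul, ← h,
      map_sum, LinearMap.sum_apply, sub_eq_zero]
    refine Finset.sum_congr rfl fun k _ => ?_
    rw [map_smul, LinearMap.smul_apply, smul_eq_mul, hsymm (v k) (v i)]
    ring
  exact (sub_eq_zero.1 hy0).symm

end ObtuseFamily

/-! ### Projections of equal rank -/

theorem eigenvalues_eq_ite_of_idempotent {m : ℕ} {A : Matrix (Fin m) (Fin m) 𝕜}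
    (hA : A.IsHermitian) (hAA : A * A = A) (i : Fin m) :
    hA.eigenvalues i = if hA.eigenvalues i ≠ 0 then 1 else 0 := by
  have h : IsIdempotentElem A := hAA
  have h1 := h.spectrum_subset ℝ (hA.eigenvalues_mem_spectrum_real i)
  rcases h1 with h1 | h1
  · simp [h1]
  · rw [Set.mem_singleton_iff] at h1
    simp [h1]

theorem trace_eq_rank_of_idempotent {m : ℕ} {A : Matrix (Fin m) (Fin m) 𝕜}
    (hA : A.IsHermitian) (hAA : A * A = A) : A.trace = (A.rank : 𝕜) := by
  rw [hA.trace_eq_sum_eigenvalues, hA.rank_eq_card_non_zero_eigs, Fintype.card_subtype,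
    Finset.sum_congr rfl fun i _ => congrArg _ (eigenvalues_eq_ite_of_idempotent hA hAA i),
    ← RCLike.ofReal_sum, Finset.sum_boole]
  simp

/-- Two orthogonal projections of the same rank are unitarily equivalent. -/
theorem exists_unitary_conj_of_rank_eq {m : ℕ} {A C : Matrix (Fin m) (Fin m) 𝕜}
    (hA : A.IsHermitian) (hAA : A * A = A) (hC : C.IsHermitian) (hCC : C * C = C)
    (hrank : A.rank = C.rank) :
    ∃ V : Matrix.unitaryGroup (Fin m) 𝕜,
      A = (V : Matrix (Fin m) (Fin m) 𝕜) * C * star (V : Matrix (Fin m) (Fin m) 𝕜) := by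
  have hchar : ∀ {D : Matrix (Fin m) (Fin m) 𝕜} (_ : D.IsHermitian) (_ : D * D = D),
      D.charpoly = (Polynomial.X - 1) ^ D.rank * Polynomial.X ^ (m - D.rank) := by
    intro D hD hDD
    have hcard := Finset.card_filter_add_card_filter_not (s := (Finset.univ : Finset (Fin m)))
      (fun i => hD.eigenvalues i ≠ 0)
    have hr : D.rank = (Finset.univ.filter fun i => hD.eigenvalues i ≠ 0).card := by
      rw [hD.rank_eq_card_non_zero_eigs, Fintype.card_subtype]
    rw [Finset.card_univ, Fintype.card_fin, ← hr] at hcard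
    have hm : m - D.rank = (Finset.univ.filter fun i => ¬ hD.eigenvalues i ≠ 0).card := by omega
    rw [hD.charpoly_eq, hm, hr, ← Finset.prod_const, ← Finset.prod_const, ← Finset.prod_ite]
    refine Finset.prod_congr rfl fun i _ => ?_
    rw [eigenvalues_eq_ite_of_idempotent hD hDD i]
    split_ifs <;> simp_all
  have heig : hA.eigenvalues = hC.eigenvalues :=
    (hA.eigenvalues_eq_eigenvalues_iff hC).2 (by rw [hchar hA hAA, hchar hC hCC, hrank])
  refine ⟨hA.eigenvectorUnitary * hC.eigenvectorUnitary⁻¹, ?_⟩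
  have h1 := hA.spectral_theorem
  have h2 := hC.spectral_theorem
  rw [Unitary.conjStarAlgAut_apply] at h1 h2
  rw [← heig] at h2
  set a : Matrix (Fin m) (Fin m) 𝕜 := (hA.eigenvectorUnitary : Matrix (Fin m) (Fin m) 𝕜)
  set c : Matrix (Fin m) (Fin m) 𝕜 := (hC.eigenvectorUnitary : Matrix (Fin m) (Fin m) 𝕜)
  have hc : star c * c = 1 := Unitary.coe_star_mul_self _
  have hinv : ((hA.eigenvectorUnitary * hC.eigenvectorUnitary⁻¹ :
      Matrix.unitaryGroup (Fin m) 𝕜) : Matrix (Fin m) (Fin m) 𝕜) = a * star c := rfl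
  rw [hinv]
  nth_rewrite 1 [h2]
  rw [star_mul, star_star]
  conv_lhs => rw [h1]
  calc _ = a * ((star c * c) * diagonal (RCLike.ofReal ∘ hA.eigenvalues) * (star c * c)) *
        star a := by
        rw [hc, one_mul, mul_one]
    _ = _ := by simp only [mul_assoc]

/-! ### Traceless Hermitian matrices -/

/-- The real vector space of Hermitian matrices. -/
def hermitianSubmodule (𝕜 : Type*) [RCLike 𝕜] (m : ℕ) :
    Submodule ℝ (Matrix (Fin m) (Fin m) 𝕜) where
  carrier := {A | A.IsHermitian}
  add_mem' := fun ha hb => ha.add hb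
  zero_mem' := Matrix.isHermitian_zero
  smul_mem' := fun c A hA => by
    change (c • A)ᴴ = c • A
    rw [Matrix.conjTranspose_smul, star_trivial, hA.eq]

/-- The real vector space of traceless Hermitian matrices. -/
def tracelessHermitianSubmodule (𝕜 : Type*) [RCLike 𝕜] (m : ℕ) :
    Submodule ℝ (Matrix (Fin m) (Fin m) 𝕜) :=
  hermitianSubmodule 𝕜 m ⊓ LinearMap.ker (Matrix.traceLinearMap (Fin m) ℝ 𝕜)

theorem finrank_le_card_of_forall_eq_zero {m : ℕ} {κ : Type*} [Fintype κ]
    (W : Submodule ℝ (Matrix (Fin m) (Fin m) 𝕜)) (L : Matrix (Fin m) (Fin m) 𝕜 →ₗ[ℝ] (κ → ℝ))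
    (hL : ∀ A ∈ W, L A = 0 → A = 0) : Module.finrank ℝ W ≤ Fintype.card κ := by
  have hinj : Function.Injective (L.domRestrict W) := by
    rw [injective_iff_map_eq_zero]
    rintro ⟨A, hA⟩ h
    exact Subtype.ext (hL A hA h)
  simpa using LinearMap.finrank_le_finrank_of_injective hinj

theorem finrank_hermitian_le_real (hI : (RCLike.I : 𝕜) = 0) (m : ℕ) :
    Module.finrank ℝ (hermitianSubmodule 𝕜 m) ≤ (m + 1).choose 2 := by
  classical
  have hcard : Fintype.card {p : Fin m × Fin m // p.1 ≤ p.2} = (m + 1).choose 2 := by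
    rw [← Fintype.card_congr (Sym2.sortEquiv (α := Fin m)), Sym2.card, Fintype.card_fin]
  rw [← hcard]
  have him : ∀ z : 𝕜, RCLike.re z = 0 → z = 0 := fun z hz => by
    rw [← RCLike.re_add_im z, hz, hI]
    simp
  refine finrank_le_card_of_forall_eq_zero _
    (LinearMap.pi fun p : {p : Fin m × Fin m // p.1 ≤ p.2} =>
      (RCLike.reLm : 𝕜 →ₗ[ℝ] ℝ) ∘ₗ Matrix.entryLinearMap ℝ 𝕜 p.1.1 p.1.2) fun A hA h => ?_
  have hle : ∀ i j, i ≤ j → A i j = 0 := fun i j hij => him _ (congrFun h ⟨(i, j), hij⟩)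
  ext i j
  rcases le_total i j with hij | hij
  · exact hle i j hij
  · rw [← Matrix.IsHermitian.apply hA i j, hle j i hij]
    simp

theorem finrank_hermitian_le (m : ℕ) :
    Module.finrank ℝ (hermitianSubmodule 𝕜 m) ≤ m ^ 2 := by
  classical
  have hcard : Fintype.card (Fin m × Fin m) = m ^ 2 := by simp [sq]
  rw [← hcard]
  refine finrank_le_card_of_forall_eq_zero _
    (LinearMap.pi fun p : Fin m × Fin m =>
      (if p.1 ≤ p.2 then (RCLike.reLm : 𝕜 →ₗ[ℝ] ℝ) else (RCLike.imLm : 𝕜 →ₗ[ℝ] ℝ)) ∘ₗ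
        Matrix.entryLinearMap ℝ 𝕜 p.1 p.2) fun A hA h => ?_
  have hre : ∀ i j, i ≤ j → RCLike.re (A i j) = 0 := fun i j hij => by
    simpa [hij] using congrFun h (i, j)
  have him : ∀ i j, j < i → RCLike.im (A i j) = 0 := fun i j hij => by
    simpa [hij.not_ge] using congrFun h (i, j)
  have happ := Matrix.IsHermitian.apply (A := A) hA
  ext i j
  rw [Matrix.zero_apply]
  apply RCLike.ext
  · rw [map_zero]
    rcases le_total i j with hij | hij
    · exact hre i j hij
    · rw [← happ i j, ← starRingEnd_apply, RCLike.conj_re, hre j i hij]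
  · rw [map_zero]
    rcases lt_trichotomy i j with hij | rfl | hij
    · rw [← happ i j, ← starRingEnd_apply, RCLike.conj_im, him j i hij, neg_zero]
    · have := congrArg RCLike.im (happ i i)
      rw [← starRingEnd_apply, RCLike.conj_im] at this
      linarith
    · exact him i j hij

theorem finrank_tracelessHermitian_le {m : ℕ} (hm : 0 < m) :
    Module.finrank ℝ (tracelessHermitianSubmodule 𝕜 m) ≤ dF 𝕜 m := by
  have hlt : tracelessHermitianSubmodule 𝕜 m < hermitianSubmodule 𝕜 m := by
    refine lt_of_le_of_ne inf_le_left fun h => ?_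
    have h1 : (1 : Matrix (Fin m) (Fin m) 𝕜) ∈ tracelessHermitianSubmodule 𝕜 m :=
      h ▸ (Matrix.isHermitian_one : (1 : Matrix (Fin m) (Fin m) 𝕜).IsHermitian)
    have h2 : (1 : Matrix (Fin m) (Fin m) 𝕜).trace = 0 := h1.2
    simp [hm.ne'] at h2
  have hfin := Submodule.finrank_lt_finrank_of_lt hlt
  unfold dF
  split_ifs with hI
  · have h := finrank_hermitian_le_real hI m
    have h2 : (m + 1).choose 2 = (m + 2) * (m - 1) / 2 + 1 := by
      obtain ⟨k, rfl⟩ : ∃ k, m = k + 1 := ⟨m - 1, by omega⟩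
      rw [Nat.choose_two_right, Nat.add_sub_cancel, Nat.add_sub_cancel,
        show (k + 1 + 1) * (k + 1) = (k + 1 + 2) * k + 1 * 2 by ring,
        Nat.add_mul_div_right _ _ two_pos]
    omega
  · have h := finrank_hermitian_le (𝕜 := 𝕜) m
    omega

/-- The real bilinear form `(X, Y) ↦ Re tr (X Y)`. -/
def reTraceForm (𝕜 : Type*) [RCLike 𝕜] (m : ℕ) :
    LinearMap.BilinForm ℝ (Matrix (Fin m) (Fin m) 𝕜) :=
  (LinearMap.mul ℝ (Matrix (Fin m) (Fin m) 𝕜)).compr₂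
    ((RCLike.reLm : 𝕜 →ₗ[ℝ] ℝ) ∘ₗ Matrix.traceLinearMap (Fin m) ℝ 𝕜)

theorem reTraceForm_apply {m : ℕ} (X Y : Matrix (Fin m) (Fin m) 𝕜) :
    reTraceForm 𝕜 m X Y = RCLike.re (X * Y).trace := rfl

theorem reTraceForm_comm {m : ℕ} (X Y : Matrix (Fin m) (Fin m) 𝕜) :
    reTraceForm 𝕜 m X Y = reTraceForm 𝕜 m Y X := by
  rw [reTraceForm_apply, reTraceForm_apply, Matrix.trace_mul_comm]

theorem reTraceForm_self_pos {m : ℕ} {X : Matrix (Fin m) (Fin m) 𝕜} (hX : X.IsHermitian)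
    (h0 : X ≠ 0) : 0 < reTraceForm 𝕜 m X X := by
  have h : reTraceForm 𝕜 m X X = ∑ i, ∑ j, ‖X i j‖ ^ 2 := by
    rw [reTraceForm_apply, Matrix.trace, map_sum]
    refine Finset.sum_congr rfl fun i _ => ?_
    rw [Matrix.diag_apply, Matrix.mul_apply, map_sum]
    refine Finset.sum_congr rfl fun j _ => ?_
    rw [← hX.apply j i, ← starRingEnd_apply, RCLike.mul_conj]
    norm_cast
  obtain ⟨i, j, hij⟩ : ∃ i j, X i j ≠ 0 := by
    by_contra! hcon
    exact h0 (Matrix.ext hcon)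
  rw [h]
  refine Finset.sum_pos' (fun i _ => by positivity) ⟨i, Finset.mem_univ _, ?_⟩
  exact Finset.sum_pos' (fun i _ => by positivity) ⟨j, Finset.mem_univ _, by positivity⟩

theorem trace_mul_eq_ofReal_re {m : ℕ} {X Y : Matrix (Fin m) (Fin m) 𝕜} (hX : X.IsHermitian)
    (hY : Y.IsHermitian) : (X * Y).trace = (RCLike.re (X * Y).trace : 𝕜) := by
  refine (RCLike.conj_eq_iff_re.1 ?_).symm
  rw [starRingEnd_apply, ← Matrix.trace_conjTranspose, Matrix.conjTranspose_mul, hX.eq, hY.eq,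
    Matrix.trace_mul_comm]

/-! ### Centered projections of half rank -/

theorem sub_half_mem_tracelessHermitian {m : ℕ} {R : Matrix (Fin m) (Fin m) 𝕜}
    (hR : R.IsHermitian) (htr : (2 : 𝕜) * R.trace = m) :
    R - (1 / 2 : ℝ) • (1 : Matrix (Fin m) (Fin m) 𝕜) ∈ tracelessHermitianSubmodule 𝕜 m := by
  refine ⟨(hermitianSubmodule 𝕜 m).sub_mem hR
    ((hermitianSubmodule 𝕜 m).smul_mem _ Matrix.isHermitian_one), ?_⟩
  change (R - (1 / 2 : ℝ) • (1 : Matrix (Fin m) (Fin m) 𝕜)).trace = 0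
  rw [Matrix.trace_sub, Matrix.trace_smul, Matrix.trace_one, Fintype.card_fin, ← htr,
    RCLike.real_smul_eq_coe_mul]
  push_cast
  ring

theorem reTraceForm_sub_half {m : ℕ} {R S : Matrix (Fin m) (Fin m) 𝕜}
    (hR : (2 : 𝕜) * R.trace = m) (hS : (2 : 𝕜) * S.trace = m) :
    reTraceForm 𝕜 m (R - (1 / 2 : ℝ) • 1) (S - (1 / 2 : ℝ) • 1) =
      RCLike.re (R * S).trace - m / 4 := by
  have hre : ∀ {T : Matrix (Fin m) (Fin m) 𝕜}, (2 : 𝕜) * T.trace = m →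
      RCLike.re T.trace = (m : ℝ) / 2 := fun {T} h => by
    have := congrArg RCLike.re h
    rw [← Nat.cast_ofNat, ← RCLike.ofReal_natCast, RCLike.re_ofReal_mul, RCLike.natCast_re] at this
    push_cast at this
    linarith
  have h1 : reTraceForm 𝕜 m 1 1 = m := by
    rw [reTraceForm_apply, one_mul, Matrix.trace_one, Fintype.card_fin, RCLike.natCast_re]
  have h2 : reTraceForm 𝕜 m R 1 = m / 2 := by rw [reTraceForm_apply, mul_one, hre hR]
  have h3 : reTraceForm 𝕜 m 1 S = m / 2 := by rw [reTraceForm_apply, one_mul, hre hS]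
  rw [LinearMap.map_sub₂, LinearMap.map_smul₂, map_sub, map_sub, map_smul, map_smul, h1, h2, h3,
    ← reTraceForm_apply]
  simp only [smul_eq_mul]
  ring

/-- For a maximal orthoplectic family the centered projections sum to zero and form a tight frame
of the traceless Hermitian matrices. -/
theorem sum_sub_half_eq_zero_and_frame {n m : ℕ} (hm : 0 < m) (hn : n = 2 * dF 𝕜 m)
    (P : Fin n → Matrix (Fin m) (Fin m) 𝕜) (hP : ∀ j, (P j).IsHermitian)
    (hPP : ∀ j, P j * P j = P j) (htr : ∀ j, (2 : 𝕜) * (P j).trace = m)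
    (hle : ∀ j k, j ≠ k → RCLike.re (P j * P k).trace ≤ (m : ℝ) / 4) :
    ∑ j, (P j - (1 / 2 : ℝ) • (1 : Matrix (Fin m) (Fin m) 𝕜)) = 0 ∧
      ∀ X ∈ tracelessHermitianSubmodule 𝕜 m,
        ∑ j, reTraceForm 𝕜 m X (P j - (1 / 2 : ℝ) • 1) • (P j - (1 / 2 : ℝ) • 1) =
          ((m : ℝ) / 2) • X := by
  have hm' : (0 : ℝ) < m := by exact_mod_cast hm
  have h := sum_eq_zero_and_sum_smul_eq_of_nonpos (reTraceForm 𝕜 m) reTraceForm_comm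
    (tracelessHermitianSubmodule 𝕜 m) (fun X hX h0 => reTraceForm_self_pos hX.1 h0) hn
    (finrank_tracelessHermitian_le hm)
    (fun j => P j - (1 / 2 : ℝ) • (1 : Matrix (Fin m) (Fin m) 𝕜))
    (fun j => sub_half_mem_tracelessHermitian (hP j) (htr j)) (c := (m : ℝ) / 4) (by positivity)
    (fun j => by
      rw [reTraceForm_sub_half (htr j) (htr j), hPP]
      have := congrArg RCLike.re (htr j)
      rw [← Nat.cast_ofNat, ← RCLike.ofReal_natCast, RCLike.re_ofReal_mul,
        RCLike.natCast_re] at this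
      push_cast at this
      linarith)
    (fun j k hjk => by
      rw [reTraceForm_sub_half (htr j) (htr k)]
      linarith [hle j k hjk])
  refine ⟨h.1, fun X hX => ?_⟩
  rw [h.2 X hX]
  congr 1
  ring

theorem sum_sq_re_trace_mul {n m : ℕ} {P : Fin n → Matrix (Fin m) (Fin m) 𝕜}
    (htr : ∀ j, (2 : 𝕜) * (P j).trace = m)
    (hsum : ∑ j, (P j - (1 / 2 : ℝ) • (1 : Matrix (Fin m) (Fin m) 𝕜)) = 0)
    (hframe : ∀ X ∈ tracelessHermitianSubmodule 𝕜 m,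
        ∑ j, reTraceForm 𝕜 m X (P j - (1 / 2 : ℝ) • 1) • (P j - (1 / 2 : ℝ) • 1) =
          ((m : ℝ) / 2) • X)
    {R : Matrix (Fin m) (Fin m) 𝕜} (hR : R.IsHermitian) (hRR : R * R = R)
    (hRtr : (2 : 𝕜) * R.trace = m) :
    ∑ j, (RCLike.re (R * P j).trace) ^ 2 = (n : ℝ) * m ^ 2 / 16 + (m : ℝ) ^ 2 / 8 := by
  set r := R - (1 / 2 : ℝ) • (1 : Matrix (Fin m) (Fin m) 𝕜) with hr
  have hrr : reTraceForm 𝕜 m r r = m / 4 := by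
    rw [hr, reTraceForm_sub_half hRtr hRtr, hRR]
    have := congrArg RCLike.re hRtr
    rw [← Nat.cast_ofNat, ← RCLike.ofReal_natCast, RCLike.re_ofReal_mul,
      RCLike.natCast_re] at this
    push_cast at this
    linarith
  have h1 := congrArg (reTraceForm 𝕜 m r) hsum
  have h2 := congrArg (reTraceForm 𝕜 m r)
    (hframe r (sub_half_mem_tracelessHermitian hR hRtr))
  rw [map_sum, map_zero] at h1
  rw [map_sum, map_smul, hrr] at h2
  simp only [map_smul, smul_eq_mul] at h2
  have h3 : ∀ j, (RCLike.re (R * P j).trace) ^ 2 =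
      reTraceForm 𝕜 m r (P j - (1 / 2 : ℝ) • 1) * reTraceForm 𝕜 m r (P j - (1 / 2 : ℝ) • 1) +
        (m / 2 * reTraceForm 𝕜 m r (P j - (1 / 2 : ℝ) • 1) + (m : ℝ) ^ 2 / 16) := fun j => by
    rw [hr, reTraceForm_sub_half hRtr (htr j)]
    ring
  rw [Finset.sum_congr rfl fun j _ => h3 j, Finset.sum_add_distrib, Finset.sum_add_distrib,
    ← Finset.mul_sum, h1, h2]
  simp
  ring

/-- Two families with the same frame identity on a subspace containing both have the same
Kronecker square sum. -/
theorem sum_kronecker_eq_of_frame {ι : Type*} [Fintype ι] {m : ℕ}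
    (W : Submodule ℝ (Matrix (Fin m) (Fin m) 𝕜)) {v w : ι → Matrix (Fin m) (Fin m) 𝕜} {c : ℝ}
    (hc : c ≠ 0) (hvW : ∀ j, v j ∈ W) (hwW : ∀ j, w j ∈ W)
    (hv : ∀ X ∈ W, ∑ j, reTraceForm 𝕜 m X (v j) • v j = c • X)
    (hw : ∀ X ∈ W, ∑ j, reTraceForm 𝕜 m X (w j) • w j = c • X) :
    ∑ j, v j ⊗ₖ v j = ∑ j, w j ⊗ₖ w j := by
  have hcinj : Function.Injective fun M : Matrix (Fin m × Fin m) (Fin m × Fin m) 𝕜 => c • M :=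
    smul_right_injective _ hc
  apply hcinj
  have hl : ∀ (f : ι → Matrix (Fin m) (Fin m) 𝕜) (Y : Matrix (Fin m) (Fin m) 𝕜),
      (∑ j, f j) ⊗ₖ Y = ∑ j, f j ⊗ₖ Y := fun f Y =>
    map_sum ((Matrix.kroneckerBilinear (R := ℝ) (α := 𝕜)).flip Y) f _
  have hr : ∀ (f : ι → Matrix (Fin m) (Fin m) 𝕜) (Y : Matrix (Fin m) (Fin m) 𝕜),
      Y ⊗ₖ (∑ j, f j) = ∑ j, Y ⊗ₖ f j := fun f Y =>
    map_sum ((Matrix.kroneckerBilinear (R := ℝ) (α := 𝕜)) Y) f _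
  calc c • ∑ j, v j ⊗ₖ v j = ∑ j, v j ⊗ₖ (c • v j) := by
        simp only [Finset.smul_sum, Matrix.kronecker_smul]
    _ = ∑ j, ∑ k, reTraceForm 𝕜 m (v j) (w k) • (v j ⊗ₖ w k) := by
        refine Finset.sum_congr rfl fun j _ => ?_
        rw [← hw _ (hvW j), hr]
        simp only [Matrix.kronecker_smul]
    _ = ∑ k, ∑ j, reTraceForm 𝕜 m (w k) (v j) • (v j ⊗ₖ w k) := by
        rw [Finset.sum_comm]
        simp only [reTraceForm_comm]
    _ = ∑ k, (c • w k) ⊗ₖ w k := by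
        refine Finset.sum_congr rfl fun k _ => ?_
        rw [← hv _ (hwW k), hl]
        simp only [Matrix.smul_kronecker]
    _ = c • ∑ j, w j ⊗ₖ w j := by
        simp only [Finset.smul_sum, Matrix.smul_kronecker]

theorem sum_kronecker_self_eq {n m : ℕ} {P : Fin n → Matrix (Fin m) (Fin m) 𝕜}
    {C : Matrix (Fin m) (Fin m) 𝕜} (hsum : ∑ j, (P j - C) = 0) :
    ∑ j, P j ⊗ₖ P j = ∑ j, (P j - C) ⊗ₖ (P j - C) + n • (C ⊗ₖ C) := by
  have hl : (∑ j, (P j - C)) ⊗ₖ C = ∑ j, (P j - C) ⊗ₖ C :=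
    map_sum ((Matrix.kroneckerBilinear (R := ℝ) (α := 𝕜)).flip C) _ _
  have hr : C ⊗ₖ (∑ j, (P j - C)) = ∑ j, C ⊗ₖ (P j - C) :=
    map_sum ((Matrix.kroneckerBilinear (R := ℝ) (α := 𝕜)) C) _ _
  rw [hsum, Matrix.zero_kronecker] at hl
  rw [hsum, Matrix.kronecker_zero] at hr
  have h : ∀ j, P j ⊗ₖ P j =
      (P j - C) ⊗ₖ (P j - C) + (P j - C) ⊗ₖ C + (C ⊗ₖ (P j - C) + C ⊗ₖ C) := fun j => by
    rw [← Matrix.kronecker_add, sub_add_cancel, ← Matrix.kronecker_add, sub_add_cancel,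
      ← Matrix.add_kronecker, sub_add_cancel]
  rw [Finset.sum_congr rfl fun j _ => h j]
  simp only [Finset.sum_add_distrib]
  rw [← hl, ← hr]
  simp

/-! ### The coherence tensor -/

section Coherence

variable {m : ℕ}

/-- Conjugation of a matrix by a unitary. -/
def unitaryConj (U : Matrix.unitaryGroup (Fin m) 𝕜) (A : Matrix (Fin m) (Fin m) 𝕜) :
    Matrix (Fin m) (Fin m) 𝕜 :=
  (U : Matrix (Fin m) (Fin m) 𝕜) * A * star (U : Matrix (Fin m) (Fin m) 𝕜)

theorem unitaryConj_mul (U : Matrix.unitaryGroup (Fin m) 𝕜) (A C : Matrix (Fin m) (Fin m) 𝕜) :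
    unitaryConj U A * unitaryConj U C = unitaryConj U (A * C) := by
  have h : star (U : Matrix (Fin m) (Fin m) 𝕜) * U = 1 := Unitary.coe_star_mul_self _
  calc _ = (U : Matrix (Fin m) (Fin m) 𝕜) * A * (star (U : Matrix (Fin m) (Fin m) 𝕜) * U) * C
        * star (U : Matrix (Fin m) (Fin m) 𝕜) := by
        simp only [unitaryConj, mul_assoc]
    _ = _ := by
        rw [h, mul_one]
        simp only [unitaryConj, mul_assoc]

theorem unitaryConj_trace (U : Matrix.unitaryGroup (Fin m) 𝕜) (A : Matrix (Fin m) (Fin m) 𝕜) :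
    (unitaryConj U A).trace = A.trace := by
  have h : star (U : Matrix (Fin m) (Fin m) 𝕜) * U = 1 := Unitary.coe_star_mul_self _
  rw [unitaryConj, Matrix.trace_mul_comm, ← mul_assoc, h, one_mul]

theorem unitaryConj_isHermitian (U : Matrix.unitaryGroup (Fin m) 𝕜)
    {A : Matrix (Fin m) (Fin m) 𝕜} (hA : A.IsHermitian) : (unitaryConj U A).IsHermitian :=
  Matrix.isHermitian_mul_mul_conjTranspose _ hA

theorem unitaryConj_mul_left (V U : Matrix.unitaryGroup (Fin m) 𝕜)
    (A : Matrix (Fin m) (Fin m) 𝕜) :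
    unitaryConj (V * U) A = unitaryConj V (unitaryConj U A) := by
  simp only [unitaryConj, Submonoid.coe_mul, star_mul, mul_assoc]

theorem unitaryConj_inv_trace_mul (V : Matrix.unitaryGroup (Fin m) 𝕜)
    (A C : Matrix (Fin m) (Fin m) 𝕜) :
    (unitaryConj V⁻¹ A * C).trace = (A * unitaryConj V C).trace := by
  have hC : unitaryConj V⁻¹ (unitaryConj V C) = C := by
    rw [← unitaryConj_mul_left, inv_mul_cancel]
    simp [unitaryConj]
  nth_rewrite 1 [← hC]
  rw [unitaryConj_mul, unitaryConj_trace]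

/-- A linear functional commutes with the integral of a finite combination of fixed vectors with
integrable coefficients. -/
theorem linearMap_integral_sum_smul {X : Type*} [MeasurableSpace X] {ν : Measure X} {F : Type*}
    [NormedAddCommGroup F] [NormedSpace 𝕜 F] [NormedSpace ℝ F] [FiniteDimensional 𝕜 F]
    {κ : Type*} [Fintype κ] (e : κ → F) {g : X → κ → 𝕜}
    (hg : ∀ k, Integrable (fun x => g x k) ν) (L : F →ₗ[𝕜] 𝕜) :
    L (∫ x, ∑ k, g x k • e k ∂ν) = ∫ x, L (∑ k, g x k • e k) ∂ν := by
  have : CompleteSpace F := FiniteDimensional.complete 𝕜 F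
  exact (L.toContinuousLinearMap.integral_comp_comm
    (integrable_finsetSum _ fun k _ => (hg k).smul_const (e k))).symm

variable {Q : Matrix (Fin m) (Fin m) 𝕜} {μ : Measure (Matrix.unitaryGroup (Fin m) 𝕜)}

theorem memLp_unitaryConj_apply (i j : Fin m) :
    MemLp (fun U : Matrix.unitaryGroup (Fin m) 𝕜 => unitaryConj U Q i j) ⊤ μ := by
  have hU : ∀ i j, MemLp (fun U : Matrix.unitaryGroup (Fin m) 𝕜 =>
      (U : Matrix (Fin m) (Fin m) 𝕜) i j) ⊤ μ := fun i j => by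
    have hmeas : Measurable fun U : Matrix.unitaryGroup (Fin m) 𝕜 =>
        (U : Matrix (Fin m) (Fin m) 𝕜) i j := by
      have h : Measurable fun A : Fin m → Fin m → 𝕜 => A i j :=
        (measurable_pi_apply j).comp (measurable_pi_apply i)
      exact Measurable.comp (g := fun A : Matrix (Fin m) (Fin m) 𝕜 => A i j) h
        measurable_subtype_coe
    exact memLp_top_of_bound hmeas.aestronglyMeasurable 1
      (Filter.Eventually.of_forall fun U => entry_norm_bound_of_unitary U.2 i j)
  simp only [unitaryConj, Matrix.mul_apply, Finset.sum_mul, Matrix.star_apply]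
  refine memLp_finsetSum _ fun b _ => memLp_finsetSum _ fun a _ => ?_
  exact MemLp.mul (r := ⊤) (hU j b).star ((hU i a).mul_const (Q a b))

variable [IsProbabilityMeasure μ]

theorem integrable_trace_sq (Y : Matrix (Fin m) (Fin m) 𝕜) :
    Integrable (fun U : Matrix.unitaryGroup (Fin m) 𝕜 => (unitaryConj U Q * Y).trace ^ 2) μ := by
  have h : MemLp (fun U : Matrix.unitaryGroup (Fin m) 𝕜 => (unitaryConj U Q * Y).trace) ⊤ μ := by
    simp only [Matrix.trace, Matrix.diag_apply, Matrix.mul_apply]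
    exact memLp_finsetSum _ fun i _ => memLp_finsetSum _ fun j _ =>
      (memLp_unitaryConj_apply i j).mul_const (Y j i)
  simp only [sq]
  exact (MemLp.mul (r := ⊤) h h).integrable le_top

theorem trace_integral_mul (X : Matrix (Fin m × Fin m) (Fin m × Fin m) 𝕜) :
    ((∫ U : Matrix.unitaryGroup (Fin m) 𝕜, unitaryConj U Q ⊗ₖ unitaryConj U Q ∂μ) * X).trace =
      ∫ U, ((unitaryConj U Q ⊗ₖ unitaryConj U Q) * X).trace ∂μ := by
  have hsum : ∀ U : Matrix.unitaryGroup (Fin m) 𝕜, unitaryConj U Q ⊗ₖ unitaryConj U Q =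
      ∑ k : (Fin m × Fin m) × (Fin m × Fin m), (unitaryConj U Q ⊗ₖ unitaryConj U Q) k.1 k.2 •
        (Matrix.single k.1 k.2 1 : Matrix (Fin m × Fin m) (Fin m × Fin m) 𝕜) := fun U => by
    conv_lhs => rw [Matrix.matrix_eq_sum_single (unitaryConj U Q ⊗ₖ unitaryConj U Q)]
    simp only [Matrix.smul_single, smul_eq_mul, mul_one, Fintype.sum_prod_type]
  have h := linearMap_integral_sum_smul (ν := μ)
    (fun k : (Fin m × Fin m) × (Fin m × Fin m) =>
      (Matrix.single k.1 k.2 1 : Matrix (Fin m × Fin m) (Fin m × Fin m) 𝕜))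
    (g := fun U k => (unitaryConj U Q ⊗ₖ unitaryConj U Q) k.1 k.2)
    (fun k => (MemLp.mul (r := ⊤) (memLp_unitaryConj_apply k.1.2 k.2.2)
      (memLp_unitaryConj_apply k.1.1 k.2.1)).integrable le_top)
    (Matrix.traceLinearMap (Fin m × Fin m) 𝕜 𝕜 ∘ₗ LinearMap.mulRight 𝕜 X)
  simp only [← hsum] at h
  exact h

theorem trace_integral_mul_kronecker (Y : Matrix (Fin m) (Fin m) 𝕜) :
    ((∫ U : Matrix.unitaryGroup (Fin m) 𝕜, unitaryConj U Q ⊗ₖ unitaryConj U Q ∂μ) *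
      (Y ⊗ₖ Y)).trace = ∫ U, (unitaryConj U Q * Y).trace ^ 2 ∂μ := by
  rw [trace_integral_mul]
  simp only [← Matrix.mul_kronecker_mul, Matrix.trace_kronecker, sq]

theorem integral_trace_sq_unitaryConj
    (hinv : ∀ V : Matrix.unitaryGroup (Fin m) 𝕜, Measure.map (fun U => V * U) μ = μ)
    (V : Matrix.unitaryGroup (Fin m) 𝕜) (Y : Matrix (Fin m) (Fin m) 𝕜) :
    ∫ U, (unitaryConj U Q * unitaryConj V Y).trace ^ 2 ∂μ =
      ∫ U, (unitaryConj U Q * Y).trace ^ 2 ∂μ := by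
  have hmeas : AEMeasurable (fun U => V⁻¹ * U) μ :=
    AEMeasurable.of_map_ne_zero (by
      rw [hinv]
      exact IsProbabilityMeasure.ne_zero μ)
  have hint : AEStronglyMeasurable (fun U => (unitaryConj U Q * Y).trace ^ 2)
      (Measure.map (fun U => V⁻¹ * U) μ) := by
    rw [hinv]
    exact (integrable_trace_sq Y).aestronglyMeasurable
  have h := integral_map hmeas hint
  rw [hinv] at h
  rw [h]
  simp only [unitaryConj_mul_left, unitaryConj_inv_trace_mul]

theorem trace_integral_sq
    (hinv : ∀ V : Matrix.unitaryGroup (Fin m) 𝕜, Measure.map (fun U => V * U) μ = μ)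
    {K : Matrix (Fin m × Fin m) (Fin m × Fin m) 𝕜}
    (hK : K = ∫ U : Matrix.unitaryGroup (Fin m) 𝕜, unitaryConj U Q ⊗ₖ unitaryConj U Q ∂μ) :
    (K * K).trace = ∫ U, (unitaryConj U Q * Q).trace ^ 2 ∂μ := by
  have h1 : ∀ U, ((unitaryConj U Q ⊗ₖ unitaryConj U Q) * K).trace =
      ∫ U, (unitaryConj U Q * Q).trace ^ 2 ∂μ := fun U => by
    rw [Matrix.trace_mul_comm, hK, trace_integral_mul_kronecker,
      integral_trace_sq_unitaryConj hinv]
  nth_rewrite 1 [hK]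
  rw [trace_integral_mul]
  simp only [h1]
  simp

end Coherence

theorem stmt8 {n l m : ℕ} (hm : m = 2 * l) (hl : 0 < l)
    (hn : n = 2 * dF 𝕜 m)
    (P : Fin n → Matrix (Fin m) (Fin m) 𝕜)
    (hFF : IsFusionFrame l P)
    -- the maximal cross inner product equals `(m/2)²/m = m/4`
    (hmaxle : ∀ j k : Fin n, j ≠ k → RCLike.re ((P j * P k).trace) ≤ (m : ℝ) / 4)
    (hmaxeq : ∃ j k : Fin n, j ≠ k ∧ RCLike.re ((P j * P k).trace) = (m : ℝ) / 4)
    -- a fixed rank-`m/2` orthogonal projection and the `2`-coherence tensor `K_{2,m/2,m}`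
    (Q : Matrix (Fin m) (Fin m) 𝕜) (hQ : Q.IsHermitian ∧ Q * Q = Q ∧ Q.rank = l)
    (μ : Measure (Matrix.unitaryGroup (Fin m) 𝕜)) [IsProbabilityMeasure μ]
    (hinv : ∀ V : Matrix.unitaryGroup (Fin m) 𝕜,
      Measure.map (fun U => V * U) μ = μ)
    (K : Matrix (Fin m × Fin m) (Fin m × Fin m) 𝕜)
    (hK : K = ∫ U : Matrix.unitaryGroup (Fin m) 𝕜,
      (((U : Matrix (Fin m) (Fin m) 𝕜) * Q * star (U : Matrix (Fin m) (Fin m) 𝕜)) ⊗ₖ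
        ((U : Matrix (Fin m) (Fin m) 𝕜) * Q * star (U : Matrix (Fin m) (Fin m) 𝕜))) ∂μ) :
    (1 / (n : ℝ) ^ 2 * ∑ i, ∑ j, (RCLike.re ((P i * P j).trace)) ^ 2 =
      RCLike.re ((K * K).trace)) ∧
    (RCLike.re ((K * K).trace) =
      (m : ℝ) ^ 2 * ((dF 𝕜 m : ℝ) + 1) / (16 * (dF 𝕜 m : ℝ))) ∧
    IsGrassmannian2Design P := by
  classical
  obtain ⟨hP, hPP, hrank, -⟩ := hFF
  obtain ⟨hQh, hQQ, hQrank⟩ := hQ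
  have hm0 : 0 < m := by omega
  have htrace : ∀ {R : Matrix (Fin m) (Fin m) 𝕜}, R.IsHermitian → R * R = R → R.rank = l →
      (2 : 𝕜) * R.trace = m := fun h1 h2 h3 => by
    rw [trace_eq_rank_of_idempotent h1 h2, h3, hm]
    push_cast
    ring
  have htr := fun j => htrace (hP j) (hPP j) (hrank j)
  obtain ⟨hsum, hframe⟩ := sum_sub_half_eq_zero_and_frame hm0 hn P hP hPP htr hmaxle
  have hn0 : (n : ℝ) ≠ 0 := by
    obtain ⟨j, -⟩ := hmaxeq
    exact_mod_cast j.pos.ne'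
  have hd0 : (dF 𝕜 m : ℝ) ≠ 0 := fun h => hn0 (by rw [hn]; push_cast; rw [h, mul_zero])
  set T : ℝ := (n : ℝ) * m ^ 2 / 16 + (m : ℝ) ^ 2 / 8 with hT
  have hTsum : ∀ {R : Matrix (Fin m) (Fin m) 𝕜}, R.IsHermitian → R * R = R →
      (2 : 𝕜) * R.trace = m → ∑ j, (RCLike.re (R * P j).trace) ^ 2 = T :=
    fun h1 h2 h3 => sum_sq_re_trace_mul htr hsum hframe h1 h2 h3
  have hKK : RCLike.re (K * K).trace = T / n := by
    have h1 := trace_integral_sq hinv (Q := Q) hK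
    have h2 : ∀ j, (K * K).trace = ∫ U, (unitaryConj U Q * P j).trace ^ 2 ∂μ := fun j => by
      obtain ⟨V, hV⟩ := exists_unitary_conj_of_rank_eq (hP j) (hPP j) hQh hQQ
        ((hrank j).trans hQrank.symm)
      rw [h1, show P j = unitaryConj V Q from hV, integral_trace_sq_unitaryConj hinv]
    have h3 : (n : 𝕜) * (K * K).trace = (T : 𝕜) := by
      calc (n : 𝕜) * (K * K).trace
          = ∑ j : Fin n, ∫ U, (unitaryConj U Q * P j).trace ^ 2 ∂μ := by
            rw [Finset.sum_congr rfl fun j _ => (h2 j).symm]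
            simp
        _ = ∫ U, ∑ j : Fin n, (unitaryConj U Q * P j).trace ^ 2 ∂μ :=
            (integral_finsetSum _ fun j _ => integrable_trace_sq (P j)).symm
        _ = ∫ _, (T : 𝕜) ∂μ := by
            refine integral_congr_ae (Filter.Eventually.of_forall fun U => ?_)
            have hU := unitaryConj_isHermitian U hQh
            change ∑ j : Fin n, (unitaryConj U Q * P j).trace ^ 2 = (T : 𝕜)
            rw [← hTsum hU (by rw [unitaryConj_mul, hQQ])
              (by rw [unitaryConj_trace, htrace hQh hQQ hQrank])]
            push_cast
            exact Finset.sum_congr rfl fun j _ => 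
              congrArg (· ^ 2) (trace_mul_eq_ofReal_re hU (hP j))
        _ = (T : 𝕜) := by simp
    have h4 := congrArg RCLike.re h3
    rw [← RCLike.ofReal_natCast, RCLike.re_ofReal_mul, RCLike.ofReal_re] at h4
    rw [eq_div_iff hn0, mul_comm, h4]
  refine ⟨?_, ?_, fun U => ?_⟩
  · rw [hKK, Finset.sum_congr rfl fun i _ => hTsum (hP i) (hPP i) (htr i)]
    simp only [Finset.sum_const, Finset.card_univ, Fintype.card_fin, nsmul_eq_mul]
    field_simp
  · rw [hKK, hT, hn]
    push_cast
    field_simp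
    ring
  · have hUP := fun j => unitaryConj_isHermitian U (hP j)
    have hUtr : ∀ j, (2 : 𝕜) * (unitaryConj U (P j)).trace = m := fun j => by
      rw [unitaryConj_trace, htr]
    obtain ⟨hsum', hframe'⟩ := sum_sub_half_eq_zero_and_frame hm0 hn
      (fun j => unitaryConj U (P j)) hUP (fun j => by rw [unitaryConj_mul, hPP]) hUtr
      (fun j k hjk => by
        rw [unitaryConj_mul, unitaryConj_trace]
        exact hmaxle j k hjk)
    have hm2 : (m : ℝ) / 2 ≠ 0 := by positivity
    have hkey := sum_kronecker_eq_of_frame (tracelessHermitianSubmodule 𝕜 m) hm2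
      (fun j => sub_half_mem_tracelessHermitian (hP j) (htr j))
      (fun j => sub_half_mem_tracelessHermitian (hUP j) (hUtr j)) hframe hframe'
    exact (sum_kronecker_self_eq hsum).trans
      ((congrArg (· + _) hkey).trans (sum_kronecker_self_eq hsum').symm)

end
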